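/- arXiv:2505.00338 — 6 statements merged into one kernel-verified Lean document; each statement's English description precedes it below -/
import Mathlib

section
/- Let n be a natural number and let E : Fin n → Fin n → Prop be a relation (a directed graph on Fin n) that contains the Hamiltonian path, i.e., E i j holds whenever (j : ℕ) = (i : ℕ) + 1. Then every edge of E goes from left to right (for all u v, E u v implies u < v) if and only if E has no directed cycle (for all v, ¬ Relation.TransGen E v v). -/
/-- LR-sorting: if a directed graph on `Fin n` contains the Hamiltonian path
(directed from left to right), then every edge goes from left to right iff the
graph has no directed cycle. -/
theorem lr_sorting_yes_iff_dag (n : ℕ) (E : Fin n → Fin n → Prop)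
    (hpath : ∀ i j : Fin n, (j : ℕ) = (i : ℕ) + 1 → E i j) :
    (∀ u v, E u v → u < v) ↔ (∀ v, ¬ Relation.TransGen E v v) := by
  constructor
  · intro h v hv
    have key : ∀ w, Relation.TransGen E v w → v < w := by
      intro w hw
      induction hw with
      | single h1 => exact h _ _ h1
      | tail _ h2 ih => exact lt_trans ih (h _ _ h2)
    exact lt_irrefl v (key v hv)
  · intro h u v huv
    by_contra hlt
    have key : ∀ k : ℕ, ∀ w : Fin n, (w : ℕ) = (v : ℕ) + k →
        Relation.ReflTransGen E v w := by
      intro k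
      induction k with
      | zero =>
        intro w hw
        have : w = v := Fin.ext (by simpa using hw)
        rw [this]
      | succ k ih =>
        intro w hw
        have hk : (v : ℕ) + k < n := by have := w.isLt; omega
        exact (ih ⟨(v : ℕ) + k, hk⟩ rfl).tail (hpath _ _ (by simp only []; omega))
    have hle : (v : ℕ) ≤ (u : ℕ) := by
      rw [Fin.lt_def] at hlt
      omega
    exact h u (Relation.TransGen.head' huv (key ((u : ℕ) - v) u (by omega)))
end

section
/- Let n be a natural number and let E be a properly nested set of pairs over Fin n. Then for every pair (u,v) ∈ E, either (u,v) is the longest u-right pair (for every w, (u,w) ∈ E implies w ≤ v) or (u,v) is the longest v-left pair (for every w, (w,v) ∈ E implies u ≤ w). -/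
/-- Observation 2.1: in a properly nested set of pairs (path-outerplanar graph),
every pair `(u,v)` is either the longest `u`-right pair or the longest `v`-left pair. -/
theorem properlyNested_longest_left_or_right (n : ℕ) (E : Set (Fin n × Fin n))
    (hlt : ∀ p ∈ E, p.1 < p.2)
    (hnest : ∀ p ∈ E, ∀ q ∈ E, ¬ (p.1 < q.1 ∧ q.1 < p.2 ∧ p.2 < q.2))
    (u v : Fin n) (huv : (u, v) ∈ E) :
    (∀ w, (u, w) ∈ E → w ≤ v) ∨ (∀ w, (w, v) ∈ E → u ≤ w) := by
  by_contra h
  rw [not_or] at h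
  obtain ⟨h1, h2⟩ := h
  simp only [not_forall, not_le] at h1 h2
  obtain ⟨w, hw, hvw⟩ := h1
  obtain ⟨x, hx, hxu⟩ := h2
  exact hnest (x, v) hx (u, w) hw ⟨hxu, hlt (u, v) huv, hvw⟩
end

section
/- Let n be a natural number, let E be a properly nested set of pairs over Fin n, and let (u,v) ∈ E be a pair that has at least one enclosing pair in E. Then (u,v) has exactly one successor in E: there is a unique pair (u',v') ∈ E enclosing (u,v) such that every pair (u'',v'') ∈ E enclosing (u,v) satisfies u'' ≤ u' and v' ≤ v''. -/
/-- In a properly nested set of pairs, every pair having an enclosing pair has a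
unique successor: a unique enclosing pair minimal among all enclosing pairs. -/
theorem properlyNested_unique_successor (n : ℕ) (E : Set (Fin n × Fin n))
    (hlt : ∀ p ∈ E, p.1 < p.2)
    (hnest : ∀ p ∈ E, ∀ q ∈ E, ¬ (p.1 < q.1 ∧ q.1 < p.2 ∧ p.2 < q.2))
    (u v : Fin n) (huv : (u, v) ∈ E)
    (hencl : ∃ q ∈ E, q ≠ (u, v) ∧ q.1 ≤ u ∧ v ≤ q.2) :
    ∃! q : Fin n × Fin n, q ∈ E ∧ q ≠ (u, v) ∧ q.1 ≤ u ∧ v ≤ q.2 ∧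
      ∀ r ∈ E, r ≠ (u, v) → r.1 ≤ u → v ≤ r.2 → r.1 ≤ q.1 ∧ q.2 ≤ r.2 := by
  have huv' : u < v := hlt _ huv
  let S : Finset (Fin n × Fin n) := by
    classical exact Finset.univ.filter (fun q => q ∈ E ∧ q ≠ (u, v) ∧ q.1 ≤ u ∧ v ≤ q.2)
  have hS : ∀ q, q ∈ S ↔ (q ∈ E ∧ q ≠ (u, v) ∧ q.1 ≤ u ∧ v ≤ q.2) := by
    intro q; simp [S]
  obtain ⟨q0, h0⟩ := hencl
  obtain ⟨q, hq, hmin⟩ := Finset.exists_min_image S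
    (fun q => (q.2 : ℤ) - (q.1 : ℤ)) ⟨q0, (hS q0).2 h0⟩
  obtain ⟨hqE, hqne, hq1, hq2⟩ := (hS q).1 hq
  refine ⟨q, ⟨hqE, hqne, hq1, hq2, ?_⟩, ?_⟩
  · intro r hr hrne hr1 hr2
    have h1 := hmin r ((hS r).2 ⟨hr, hrne, hr1, hr2⟩)
    have h2 := hnest q hqE r hr
    have h3 := hnest r hr q hqE
    simp only [Fin.lt_def, Fin.le_def] at *
    omega
  · rintro r ⟨hr, hrne, hr1, hr2, hall⟩
    have h1 := hmin r ((hS r).2 ⟨hr, hrne, hr1, hr2⟩)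
    have h2 := hall q hqE hqne hq1 hq2
    have h3 := hnest q hqE r hr
    have h4 := hnest r hr q hqE
    ext <;> simp only [Fin.lt_def, Fin.le_def] at * <;> omega
end

section
/- Let n be a natural number, let E be a properly nested set of pairs over Fin n, and let (u,v) ∈ E. Then there exists a list (u₁,v₁), (u₂,v₂), …, (u_k,v_k) that enumerates, without repetition, exactly the predecessors of (u,v) in E, and that satisfies u ≤ u₁ < v₁ ≤ u₂ < v₂ ≤ … ≤ u_k < v_k ≤ v. -/
/-- Observation 2.2: in a properly nested set of pairs, the predecessors of a
pair `(u,v)` (the pairs whose successor is `(u,v)`) can be enumerated without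
repetition as `(u₁,v₁),…,(u_k,v_k)` with
`u ≤ u₁ < v₁ ≤ u₂ < v₂ ≤ … ≤ u_k < v_k ≤ v`. -/
theorem properlyNested_predecessors_ordered (n : ℕ) (E : Set (Fin n × Fin n))
    (hlt : ∀ p ∈ E, p.1 < p.2)
    (hnest : ∀ p ∈ E, ∀ q ∈ E, ¬ (p.1 < q.1 ∧ q.1 < p.2 ∧ p.2 < q.2))
    (u v : Fin n) (huv : (u, v) ∈ E) :
    ∃ l : List (Fin n × Fin n), l.Nodup ∧
      (∀ p : Fin n × Fin n, p ∈ l ↔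
        (p ∈ E ∧ (u, v) ≠ p ∧ u ≤ p.1 ∧ p.2 ≤ v ∧
          ∀ r ∈ E, r ≠ p → r.1 ≤ p.1 → p.2 ≤ r.2 → r.1 ≤ u ∧ v ≤ r.2)) ∧
      l.Chain' (fun p q => p.2 ≤ q.1) ∧
      (∀ p ∈ l, u ≤ p.1 ∧ p.1 < p.2 ∧ p.2 ≤ v) := by
  classical
  let P : Fin n × Fin n → Prop := fun p => p ∈ E ∧ (u, v) ≠ p ∧ u ≤ p.1 ∧ p.2 ≤ v ∧
          ∀ r ∈ E, r ≠ p → r.1 ≤ p.1 → p.2 ≤ r.2 → r.1 ≤ u ∧ v ≤ r.2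
  let r : Fin n × Fin n → Fin n × Fin n → Prop := fun p q => p.1 ≤ q.1
  haveI : Std.Total r := ⟨fun a b => le_total a.1 b.1⟩
  haveI : IsTrans _ r := ⟨fun a b c h1 h2 => le_trans (α := Fin n) h1 h2⟩
  let S : Finset (Fin n × Fin n) := Finset.univ.filter P
  have hperm := List.perm_insertionSort r S.toList
  have hnd : (S.toList.insertionSort r).Nodup := hperm.nodup_iff.2 S.nodup_toList
  have hmem : ∀ p, p ∈ S.toList.insertionSort r ↔ P p := by
    intro p
    rw [hperm.mem_iff]
    simp [S]
  have noenc : ∀ p q, P p → P q → p ≠ q → p.1 ≤ q.1 → q.2 ≤ p.2 → False := by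
    intro p q hp hq hne h1 h2
    obtain ⟨h3, h4⟩ := hq.2.2.2.2 p hp.1 hne h1 h2
    exact hp.2.1 (Prod.ext (le_antisymm hp.2.2.1 h3) (le_antisymm h4 hp.2.2.2.1))
  refine ⟨S.toList.insertionSort r, hnd, hmem, ?_, ?_⟩
  · apply List.Pairwise.isChain
    refine ((List.pairwise_insertionSort r S.toList).and hnd).imp_of_mem ?_
    rintro p q hp hq ⟨h, hne⟩
    rw [hmem] at hp hq
    have h : p.1 ≤ q.1 := h
    by_contra hc
    have h2 : p.2 < q.2 := not_le.1 fun h' => noenc p q hp hq hne h h'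
    have h1 : p.1 < q.1 := not_le.1 fun h' => noenc q p hq hp (Ne.symm hne) h' h2.le
    exact hnest p hp.1 q hq.1 ⟨h1, not_le.1 hc, h2⟩
  · intro p hp
    rw [hmem] at hp
    exact ⟨hp.2.2.1, hlt p hp.1, hp.2.2.2.1⟩
end

section
/- Let n be a natural number and let E be a set of pairs (u,v) of elements of Fin n with u < v. Suppose E contains a crossing pair, i.e., there exist (u,v), (u',v') ∈ E with u < u' < v < v'. Then there exists a pair (a,b) ∈ E such that: (i) some pair of E crosses (a,b) from the right, i.e., there exists (c,d) ∈ E with a < c < b < d; (ii) no pair of E crosses (a,b) from the left, i.e., there is no (c,d) ∈ E with c < a < d < b; and (iii) every pair (x,y) ∈ E with a ≤ x < y ≤ b and (x,y) ≠ (a,b) is not crossed by any pair of E (neither from the right nor from the left). -/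
/-- If a set of pairs contains a crossing pair, then there is a pair `(a,b)`
crossed from the right but not from the left, such that every pair strictly
nested within `[a,b]` is uncrossed. -/
theorem exists_deepest_crossed_pair (n : ℕ) (E : Set (Fin n × Fin n))
    (hlt : ∀ p ∈ E, p.1 < p.2)
    (hcross : ∃ p ∈ E, ∃ q ∈ E, p.1 < q.1 ∧ q.1 < p.2 ∧ p.2 < q.2) :
    ∃ a b : Fin n, (a, b) ∈ E ∧
      (∃ c d : Fin n, (c, d) ∈ E ∧ a < c ∧ c < b ∧ b < d) ∧
      (¬ ∃ c d : Fin n, (c, d) ∈ E ∧ c < a ∧ a < d ∧ d < b) ∧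
      (∀ x y : Fin n, (x, y) ∈ E → a ≤ x → y ≤ b → (x, y) ≠ (a, b) →
        (¬ ∃ c d : Fin n, (c, d) ∈ E ∧ x < c ∧ c < y ∧ y < d) ∧
        (¬ ∃ c d : Fin n, (c, d) ∈ E ∧ c < x ∧ x < d ∧ d < y)) := by
  obtain ⟨p0, hp0, q0, hq0, h0⟩ := hcross
  let S : Set (Fin n × Fin n) :=
    {p | p ∈ E ∧ ∃ c d : Fin n, (c, d) ∈ E ∧ p.1 < c ∧ c < p.2 ∧ p.2 < d}
  have hS0 : p0 ∈ S := ⟨hp0, q0.1, q0.2, hq0, h0⟩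
  -- minimise the right endpoint, then maximise the left endpoint
  obtain ⟨r, hr, hrmin⟩ := Set.exists_min_image S (fun p => p.2) (Set.toFinite S) ⟨p0, hS0⟩
  obtain ⟨⟨a, b⟩, ⟨hs, hsb⟩, hsmax⟩ :=
    Set.exists_max_image {p | p ∈ S ∧ p.2 = r.2} (fun p => p.1) (Set.toFinite _) ⟨r, hr, rfl⟩
  simp only at hsb
  subst hsb
  have hleft : ∀ x y c d : Fin n, (x, y) ∈ E → y ≤ r.2 → (c, d) ∈ E →
      c < x → x < d → d < y → False := by
    intro x y c d hxy hy hcd h1 h2 h3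
    have := hrmin (c, d) ⟨hcd, x, y, hxy, h1, h2, h3⟩
    exact absurd (lt_of_lt_of_le h3 hy) (not_lt.mpr this)
  refine ⟨a, r.2, hs.1, hs.2, ?_, ?_⟩
  · rintro ⟨c, d, hcd, h1, h2, h3⟩
    exact hleft _ _ c d hs.1 le_rfl hcd h1 h2 h3
  · intro x y hxy hax hyb hne
    refine ⟨fun hc => ?_, ?_⟩
    · have hm : (x, y) ∈ S := ⟨hxy, hc⟩
      have hy : y = r.2 := le_antisymm hyb (hrmin _ hm)
      have hx : x = a := le_antisymm (hsmax (x, y) ⟨hm, hy⟩) hax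
      exact hne (by rw [hx, hy])
    · rintro ⟨c, d, hcd, h1, h2, h3⟩
      exact hleft _ _ c d hxy hyb hcd h1 h2 h3
end

section
/- Let G be a simple graph on a vertex type V, and let (r, parent, depth) be rooted spanning tree data for G: depth r = 0; depth v = 0 implies v = r; and for every v ≠ r, G.Adj v (parent v) and depth v = depth (parent v) + 1. Define π₂(v) = parent v if depth v is even and v ≠ r, and π₂(v) = v otherwise. Let c : V → α be a labeling such that: (A) c v = c (parent v) for every v ≠ r with depth v even; and (B) for all adjacent u, w in G with π₂(u) ≠ π₂(w), c u ≠ c w. Then for every vertex v with depth v odd and every vertex u: (G.Adj v u and depth u is even and c u = c v) holds if and only if (u ≠ r and parent u = v). In other words, each odd-depth vertex can identify its children as exactly its even-depth neighbors carrying the same label. -/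
/-- Decoding children from a proper coloring of the even-contracted graph:
given rooted spanning tree data for `G` and a labeling `c` which is constant on
each even-depth-non-root-vertex-to-parent contraction class and proper on the
contracted graph, each odd-depth vertex identifies its children as exactly its
even-depth neighbors carrying the same label. -/
theorem children_decoding_from_contracted_coloring {V α : Type*} [DecidableEq V]
    (G : SimpleGraph V) (r : V) (parent : V → V) (depth : V → ℕ)
    (hr : depth r = 0) (hroot : ∀ v, depth v = 0 → v = r)
    (hpar : ∀ v, v ≠ r → G.Adj v (parent v) ∧ depth v = depth (parent v) + 1)
    (c : V → α)
    (hA : ∀ v, v ≠ r → Even (depth v) → c v = c (parent v))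
    (hB : ∀ u w, G.Adj u w →
      (if Even (depth u) ∧ u ≠ r then parent u else u) ≠
        (if Even (depth w) ∧ w ≠ r then parent w else w) →
      c u ≠ c w) :
    ∀ v, Odd (depth v) → ∀ u,
      (G.Adj v u ∧ Even (depth u) ∧ c u = c v) ↔ (u ≠ r ∧ parent u = v) := by
  intro v hv u
  have hv' : ¬ Even (depth v) := Nat.not_even_iff_odd.mpr hv
  constructor
  · rintro ⟨hadj, hu, hc⟩
    have h := hB v u hadj
    rw [if_neg (fun h => hv' h.1)] at h
    by_cases hur : u = r
    · rw [if_neg (fun h => h.2 hur)] at h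
      exact absurd hc.symm (h hadj.ne)
    · rw [if_pos ⟨hu, hur⟩] at h
      refine ⟨hur, ?_⟩
      by_contra hne
      exact h (fun e => hne e.symm) hc.symm
  · rintro ⟨hur, rfl⟩
    obtain ⟨h1, h2⟩ := hpar u hur
    have he : Even (depth u) := by rw [h2]; exact hv.add_one
    exact ⟨h1.symm, he, hA u hur he⟩
end
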